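/- The canonical ideal j(g) is abelian (i.e. [x, y] = 0 for all x, y ∈ j(g)) if and only if there exists ℓ ≥ 1 such that g^ℓ is abelian (i.e. [u, v] = 0 for all u, v ∈ g^ℓ). -/

import Mathlib

/-- The descending central series of a Lie algebra: `g^0 = g`, `g^k = [g, g^{k-1}]`
(the span of such brackets), as submodules. -/
def dcs (F : Type*) [Field F] (g : Type*) [LieRing g] [LieAlgebra F g] :
    ℕ → Submodule F g
  | 0 => ⊤
  | k + 1 => Submodule.span F {z : g | ∃ x : g, ∃ w ∈ dcs F g k, z = ⁅x, w⁆}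

/-- The derived (upper) central series of a Lie algebra:
`C_0(g) = {0}`, `C_k(g) = {x : [x, g] ⊆ C_{k-1}(g)}`, as submodules. -/
def ucs (F : Type*) [Field F] (g : Type*) [LieRing g] [LieAlgebra F g] :
    ℕ → Submodule F g
  | 0 => ⊥
  | k + 1 =>
    { carrier := {x : g | ∀ y : g, ⁅x, y⁆ ∈ ucs F g k}
      add_mem' := fun {u v} hu hv y => by
        rw [add_lie]; exact (ucs F g k).add_mem (hu y) (hv y)
      zero_mem' := fun y => by
        rw [zero_lie]; exact (ucs F g k).zero_mem
      smul_mem' := fun c u hu y => by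
        rw [smul_lie]; exact (ucs F g k).smul_mem c (hu y) }

/-- The canonical ideal `i(g) = Σ_{k≥1} (C_k(g) ∩ g^k)`. -/
def iIdeal (F : Type*) [Field F] (g : Type*) [LieRing g] [LieAlgebra F g] :
    Submodule F g :=
  ⨆ k : ℕ, ⨆ _ : 1 ≤ k, (ucs F g k ⊓ dcs F g k)

/-- The canonical ideal `j(g) = ⋂_{k≥1} (C_k(g) + g^k)`. -/
def jIdeal (F : Type*) [Field F] (g : Type*) [LieRing g] [LieAlgebra F g] :
    Submodule F g :=
  ⨅ k : ℕ, ⨅ _ : 1 ≤ k, (ucs F g k ⊔ dcs F g k)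

theorem ucs_le_succ (F : Type*) [Field F] (g : Type*) [LieRing g] [LieAlgebra F g] (n : ℕ) :
    ucs F g n ≤ ucs F g (n + 1) := by
  induction n with
  | zero => exact bot_le
  | succ k ih => exact fun x hx y => ih (hx y)

theorem dcs_succ_le (F : Type*) [Field F] (g : Type*) [LieRing g] [LieAlgebra F g] (n : ℕ) :
    dcs F g (n + 1) ≤ dcs F g n := by
  induction n with
  | zero => exact le_top
  | succ k ih =>
    refine Submodule.span_mono ?_
    rintro z ⟨x, w, hw, rfl⟩
    exact ⟨x, w, ih hw, rfl⟩

theorem lie_ucs_dcs (F : Type*) [Field F] (g : Type*) [LieRing g] [LieAlgebra F g] (n : ℕ) :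
    ∀ m : ℕ, ∀ x ∈ ucs F g (m + n + 1), ∀ w ∈ dcs F g n, ⁅x, w⁆ ∈ ucs F g m := by
  induction n with
  | zero => exact fun m x hx w _ => hx w
  | succ k ih =>
    intro m x hx w hw
    change w ∈ Submodule.span F {z : g | ∃ x : g, ∃ w ∈ dcs F g k, z = ⁅x, w⁆} at hw
    induction hw using Submodule.span_induction with
    | mem z hz =>
      obtain ⟨y, v, hv, rfl⟩ := hz
      rw [leibniz_lie]
      refine Submodule.add_mem _ (ih m _ (hx y) v hv) ?_
      have h1 : ⁅x, v⁆ ∈ ucs F g (m + 1) := by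
        refine ih (m + 1) x ?_ v hv
        have e : m + 1 + k + 1 = m + (k + 1) + 1 := by omega
        rw [e]; exact hx
      rw [← lie_skew]
      exact Submodule.neg_mem _ (h1 y)
    | zero => rw [lie_zero]; exact Submodule.zero_mem _
    | add a b _ _ ha hb => rw [lie_add]; exact Submodule.add_mem _ ha hb
    | smul c a _ ha => rw [lie_smul]; exact Submodule.smul_mem _ c ha

theorem lie_ucs_dcs_zero (F : Type*) [Field F] (g : Type*) [LieRing g] [LieAlgebra F g] (n : ℕ)
    {x w : g} (hx : x ∈ ucs F g (n + 1)) (hw : w ∈ dcs F g n) : ⁅x, w⁆ = 0 := by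
  have h := lie_ucs_dcs F g n 0 x (by rwa [Nat.zero_add]) w hw
  exact (Submodule.mem_bot F).1 h

theorem j_decomp (F : Type*) [Field F] (g : Type*) [LieRing g] [LieAlgebra F g]
    {x y : g} (hx : x ∈ jIdeal F g) (hy : y ∈ jIdeal F g) (n : ℕ) :
    ∃ s ∈ ucs F g n, ∃ t ∈ ucs F g n, ∃ u ∈ dcs F g n, ∃ v ∈ dcs F g n,
      s + u = x ∧ t + v = y ∧ ⁅s, t⁆ = 0 := by
  induction n with
  | zero =>
    exact ⟨0, Submodule.zero_mem _, 0, Submodule.zero_mem _, x, Submodule.mem_top,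
      y, Submodule.mem_top, zero_add _, zero_add _, zero_lie _⟩
  | succ n ih =>
    obtain ⟨s, hs, t, ht, u, hu, v, hv, hsu, htv, hst⟩ := ih
    simp only [jIdeal, Submodule.mem_iInf] at hx hy
    obtain ⟨c, hc, u', hu', hcu⟩ := Submodule.mem_sup.1 (hx (n + 1) (by omega))
    obtain ⟨d, hd, v', hv', hdv⟩ := Submodule.mem_sup.1 (hy (n + 1) (by omega))
    have hs' := ucs_le_succ F g n hs
    have ht' := ucs_le_succ F g n ht
    have ec : c = s + (u - u') := by
      rw [← add_sub_assoc, hsu, ← hcu, add_sub_cancel_right]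
    have ed : d = t + (v - v') := by
      rw [← add_sub_assoc, htv, ← hdv, add_sub_cancel_right]
    have ha : u - u' ∈ dcs F g n := Submodule.sub_mem _ hu (dcs_succ_le F g n hu')
    have hb : v - v' ∈ dcs F g n := Submodule.sub_mem _ hv (dcs_succ_le F g n hv')
    refine ⟨c, hc, d, hd, u', hu', v', hv', hcu, hdv, ?_⟩
    have h1 : ⁅c, v - v'⁆ = 0 := lie_ucs_dcs_zero F g n hc hb
    have h2 : ⁅u - u', t⁆ = 0 := by
      rw [← lie_skew, lie_ucs_dcs_zero F g n ht' ha, neg_zero]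
    rw [ed, lie_add, h1, add_zero, ec, add_lie, hst, h2, add_zero]

/-- `j(g)` is abelian iff some term `g^ℓ` (`ℓ ≥ 1`) of the descending
central series is abelian. -/
theorem stmt9 {F : Type*} [Field F] [CharZero F] (g : Type*) [LieRing g] [LieAlgebra F g]
    [Module.Finite F g] :
    (∀ x ∈ jIdeal F g, ∀ y ∈ jIdeal F g, ⁅x, y⁆ = 0)
      ↔ ∃ ℓ : ℕ, 1 ≤ ℓ ∧ ∀ u ∈ dcs F g ℓ, ∀ v ∈ dcs F g ℓ, ⁅u, v⁆ = 0 := by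
  constructor
  · intro h
    have hanti : Antitone (dcs F g) := antitone_nat_of_succ_le (dcs_succ_le F g)
    obtain ⟨n, hn⟩ := IsArtinian.monotone_stabilizes
      (R := F) (M := g) ⟨fun k => OrderDual.toDual (dcs F g k), fun a b hab => hanti hab⟩
    have hn' : ∀ m, n ≤ m → dcs F g n = dcs F g m := fun m hm => hn m hm
    have hle : dcs F g (n + 1) ≤ jIdeal F g := by
      refine le_iInf fun k => le_iInf fun _ => le_trans ?_ le_sup_right
      rcases le_total k (n + 1) with hk | hk
      · exact hanti hk
      · rw [← hn' (n + 1) (by omega), ← hn' k (by omega)]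
    exact ⟨n + 1, by omega, fun u hu v hv => h u (hle hu) v (hle hv)⟩
  · rintro ⟨l, -, h⟩ x hx y hy
    obtain ⟨s, hs, t, ht, u, hu, v, hv, rfl, rfl, hst⟩ := j_decomp F g hx hy l
    have h1 := lie_ucs_dcs_zero F g l (ucs_le_succ F g l hs) hv
    have h2 : ⁅u, t⁆ = 0 := by
      rw [← lie_skew, lie_ucs_dcs_zero F g l (ucs_le_succ F g l ht) hu, neg_zero]
    rw [add_lie, lie_add, lie_add, hst, h1, h2, h u hu v hv]
    simp
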